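/- Let r₁, …, r₁₆ ∈ ℤ¹⁶ be the rows of the matrix M₄ from the previous statements, and define vectors over 𝔽₂ by u₁ = r₁ mod 2 (the all-ones vector) and uᵢ = (rᵢ/2) mod 2 for 2 ≤ i ≤ 16 (each rᵢ with i ≥ 2 has all entries even). Then the 𝔽₂-subspace of 𝔽₂¹⁶ spanned by u₁, …, u₁₆ has dimension 11, and it equals the row span over 𝔽₂ of the 11×16 matrix with rows (1,0,0,0,0,0,0,1,0,0,0,1,0,1,1,1), (0,1,0,0,0,0,0,1,0,0,0,1,0,1,0,0), (0,0,1,0,0,0,0,1,0,0,0,1,0,0,1,0), (0,0,0,1,0,0,0,1,0,0,0,1,0,0,0,1), (0,0,0,0,1,0,0,1,0,0,0,0,0,1,1,0), (0,0,0,0,0,1,0,1,0,0,0,0,0,1,0,1), (0,0,0,0,0,0,1,1,0,0,0,0,0,0,1,1), (0,0,0,0,0,0,0,0,1,0,0,1,0,1,1,0), (0,0,0,0,0,0,0,0,0,1,0,1,0,1,0,1), (0,0,0,0,0,0,0,0,0,0,1,1,0,0,1,1), (0,0,0,0,0,0,0,0,0,0,0,0,1,1,1,1). -/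

import Mathlib

/-- The rows of the generator matrix `M₄` of (4 times) the lattice `Λ` of the paper. -/
def M4rows : Fin 16 → Fin 16 → ℤ :=
  ![![1,1,1,1,1,1,1,1,1,1,1,1,1,1,1,1],
    ![0,2,0,0,0,0,0,2,0,0,0,2,0,2,0,0],
    ![0,0,2,0,0,0,0,2,0,0,0,2,0,0,2,0],
    ![0,0,0,2,0,0,0,2,0,0,0,2,0,0,0,2],
    ![0,0,0,0,2,0,0,2,0,0,0,0,0,2,2,0],
    ![0,0,0,0,0,2,0,2,0,0,0,0,0,2,0,2],
    ![0,0,0,0,0,0,2,2,0,0,0,0,0,0,2,2],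
    ![0,0,0,0,0,0,0,4,0,0,0,0,0,0,0,0],
    ![0,0,0,0,0,0,0,0,2,0,0,2,0,2,2,0],
    ![0,0,0,0,0,0,0,0,0,2,0,2,0,2,0,2],
    ![0,0,0,0,0,0,0,0,0,0,2,2,0,0,2,2],
    ![0,0,0,0,0,0,0,0,0,0,0,4,0,0,0,0],
    ![0,0,0,0,0,0,0,0,0,0,0,0,2,2,2,2],
    ![0,0,0,0,0,0,0,0,0,0,0,0,0,4,0,0],
    ![0,0,0,0,0,0,0,0,0,0,0,0,0,0,4,0],
    ![0,0,0,0,0,0,0,0,0,0,0,0,0,0,0,4]]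

/-- The generators of the binary code `𝒞₁₆`. -/
def C16gens : Fin 11 → Fin 16 → ZMod 2 :=
  ![![1,0,0,0,0,0,0,1,0,0,0,1,0,1,1,1],
    ![0,1,0,0,0,0,0,1,0,0,0,1,0,1,0,0],
    ![0,0,1,0,0,0,0,1,0,0,0,1,0,0,1,0],
    ![0,0,0,1,0,0,0,1,0,0,0,1,0,0,0,1],
    ![0,0,0,0,1,0,0,1,0,0,0,0,0,1,1,0],
    ![0,0,0,0,0,1,0,1,0,0,0,0,0,1,0,1],
    ![0,0,0,0,0,0,1,1,0,0,0,0,0,0,1,1],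
    ![0,0,0,0,0,0,0,0,1,0,0,1,0,1,1,0],
    ![0,0,0,0,0,0,0,0,0,1,0,1,0,1,0,1],
    ![0,0,0,0,0,0,0,0,0,0,1,1,0,0,1,1],
    ![0,0,0,0,0,0,0,0,0,0,0,0,1,1,1,1]]

/-- The pivot columns of the reduced echelon matrix `C16gens`. -/
def C16pivot : Fin 11 → Fin 16 := ![0, 1, 2, 3, 4, 5, 6, 8, 9, 10, 12]

theorem C16gens_pivot :
    ∀ i j : Fin 11, C16gens i (C16pivot j) = (Pi.single i 1 : Fin 11 → ZMod 2) j := by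
  decide +kernel

theorem linearIndependent_C16gens : LinearIndependent (ZMod 2) C16gens := by
  refine LinearIndependent.of_comp (LinearMap.funLeft (ZMod 2) (ZMod 2) C16pivot) ?_
  convert (Pi.basisFun (ZMod 2) (Fin 11)).linearIndependent using 1
  ext i j
  simpa [LinearMap.funLeft_apply] using C16gens_pivot i j

theorem stmt_9 :
    let u : Fin 16 → Fin 16 → ZMod 2 := fun i j =>
      if i = 0 then ((M4rows i j : ℤ) : ZMod 2) else ((M4rows i j / 2 : ℤ) : ZMod 2)
    Module.finrank (ZMod 2) ↥(Submodule.span (ZMod 2) (Set.range u)) = 11 ∧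
    Submodule.span (ZMod 2) (Set.range u) = Submodule.span (ZMod 2) (Set.range C16gens) := by
  intro u
  have hu_zero : u 0 = ∑ j, C16gens j := by decide +kernel
  have hu : ∀ i, i ≠ 0 → u i = 0 ∨ ∃ j, C16gens j = u i := by decide +kernel
  have hgen_zero : C16gens 0 = ∑ j, u (C16pivot j) := by decide +kernel
  have hgen : ∀ j, j ≠ 0 → C16gens j = u (C16pivot j) := by decide +kernel
  have hspan : Submodule.span (ZMod 2) (Set.range u) =
      Submodule.span (ZMod 2) (Set.range C16gens) := by
    apply le_antisymm <;> rw [Submodule.span_le] <;> rintro _ ⟨i, rfl⟩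
    · by_cases hi : i = 0
      · rw [hi, hu_zero]
        exact Submodule.sum_mem _ fun j _ => Submodule.subset_span ⟨j, rfl⟩
      · rcases hu i hi with h | h
        · rw [h]
          exact Submodule.zero_mem _
        · exact Submodule.subset_span h
    · by_cases hi : i = 0
      · rw [hi, hgen_zero]
        exact Submodule.sum_mem _ fun j _ => Submodule.subset_span ⟨_, rfl⟩
      · rw [hgen i hi]
        exact Submodule.subset_span ⟨_, rfl⟩
  refine ⟨?_, hspan⟩
  rw [hspan, finrank_span_eq_card linearIndependent_C16gens, Fintype.card_fin]
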